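/- Assume in addition that α > 3, the step-size is constant s_k ≡ s ∈ (0, 1/L], β_k ≡ β = η √s/2 for some η ∈ (0,1], and Assumption (J0) holds. Then k ‖x_k − x_{k−1}‖ → 0 as k → ∞; that is, ‖x_k − x_{k−1}‖ = o(1/k). -/

import Mathlib

set_option autoImplicit false

open Filter

/-- A deterministic Robbins–Siegmund lemma. -/
theorem summable_and_exists_tendsto_of_quasi_descent {A D a b : ℕ → ℝ}
    (hA : ∀ n, 0 ≤ A n) (hD : ∀ n, 0 ≤ D n) (ha : ∀ n, 0 ≤ a n) (hb : ∀ n, 0 ≤ b n)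
    (ha_sum : Summable a) (hb_sum : Summable b)
    (h : ∀ n, A (n + 1) + D n ≤ (1 + a n) * A n + b n) :
    Summable D ∧ ∃ l, Tendsto A atTop (nhds l) := by
  have hbound : ∀ n, A n ≤ Real.exp (∑ i ∈ Finset.range n, a i) *
      (A 0 + ∑ i ∈ Finset.range n, b i) := by
    intro n
    induction n with
    | zero => simp
    | succ n ih =>
      rw [Finset.sum_range_succ, Finset.sum_range_succ, Real.exp_add]
      have hS : 1 ≤ Real.exp (∑ i ∈ Finset.range n, a i) :=
        Real.one_le_exp (Finset.sum_nonneg fun i _ => ha i)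
      have hE : 1 + a n ≤ Real.exp (a n) := by linarith [Real.add_one_le_exp (a n)]
      have hE1 : 1 ≤ Real.exp (a n) := Real.one_le_exp (ha n)
      calc A (n + 1) ≤ (1 + a n) * A n + b n := by linarith [h n, hD n]
        _ ≤ Real.exp (a n) * (Real.exp (∑ i ∈ Finset.range n, a i) *
              (A 0 + ∑ i ∈ Finset.range n, b i)) + b n := by
            gcongr
            exact hA n
        _ ≤ Real.exp (a n) * (Real.exp (∑ i ∈ Finset.range n, a i) *
              (A 0 + ∑ i ∈ Finset.range n, b i)) +
              Real.exp (a n) * Real.exp (∑ i ∈ Finset.range n, a i) * b n := by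
            gcongr
            exact le_mul_of_one_le_left (hb n) (one_le_mul_of_one_le_of_one_le hE1 hS)
        _ = _ := by ring
  set C := Real.exp (∑' i, a i) * (A 0 + ∑' i, b i) with hC
  have hAC : ∀ n, A n ≤ C := fun n => (hbound n).trans <| by
    have := ha_sum.sum_le_tsum (Finset.range n) fun i _ => ha i
    have := hb_sum.sum_le_tsum (Finset.range n) fun i _ => hb i
    have : 0 ≤ ∑ i ∈ Finset.range n, b i := Finset.sum_nonneg fun i _ => hb i
    have := hA 0
    rw [hC]
    gcongr
  have hC0 : 0 ≤ C := (hA 0).trans (hAC 0)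
  set c : ℕ → ℝ := fun n => C * a n + b n
  have hc : ∀ n, 0 ≤ c n := fun n => add_nonneg (mul_nonneg hC0 (ha n)) (hb n)
  have hc_sum : Summable c := (ha_sum.mul_left C).add hb_sum
  have hstep : ∀ n, A (n + 1) + D n ≤ A n + c n := fun n => by
    have := mul_le_mul_of_nonneg_left (hAC n) (ha n)
    simp only [c]
    linarith [h n]
  have hc_le : ∀ n, ∑ i ∈ Finset.range n, c i ≤ ∑' i, c i := fun n =>
    hc_sum.sum_le_tsum _ fun i _ => hc i
  constructor
  · refine summable_of_sum_range_le (c := A 0 + ∑' i, c i) hD fun n => ?_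
    have : ∀ n, A n + ∑ i ∈ Finset.range n, D i ≤ A 0 + ∑ i ∈ Finset.range n, c i := by
      intro n
      induction n with
      | zero => simp
      | succ n ih =>
        rw [Finset.sum_range_succ, Finset.sum_range_succ]
        linarith [hstep n]
    linarith [this n, hA n, hc_le n]
  · have hanti : Antitone fun n => A n - ∑ i ∈ Finset.range n, c i :=
      antitone_nat_of_succ_le fun n => by
        rw [Finset.sum_range_succ]
        linarith [hstep n, hD n]
    have hbdd : BddBelow (Set.range fun n => A n - ∑ i ∈ Finset.range n, c i) := by
      refine ⟨-∑' i, c i, ?_⟩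
      rintro _ ⟨n, rfl⟩
      dsimp only
      linarith [hA n, hc_le n]
    have := (tendsto_atTop_ciInf hanti hbdd).add hc_sum.hasSum.tendsto_sum_nat
    exact ⟨_, by simpa using this⟩

theorem summable_and_exists_tendsto_of_eventually_quasi_descent {A D a b : ℕ → ℝ} (K : ℕ)
    (hA : ∀ n, 0 ≤ A n) (hD : ∀ n, 0 ≤ D n) (ha : ∀ n, 0 ≤ a n) (hb : ∀ n, 0 ≤ b n)
    (ha_sum : Summable a) (hb_sum : Summable b)
    (h : ∀ n, K ≤ n → A (n + 1) + D n ≤ (1 + a n) * A n + b n) :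
    Summable D ∧ ∃ l, Tendsto A atTop (nhds l) := by
  obtain ⟨h1, l, h2⟩ := summable_and_exists_tendsto_of_quasi_descent
    (A := fun n => A (n + K)) (D := fun n => D (n + K)) (a := fun n => a (n + K))
    (b := fun n => b (n + K)) (fun n => hA _) (fun n => hD _) (fun n => ha _) (fun n => hb _)
    ((summable_nat_add_iff K).2 ha_sum) ((summable_nat_add_iff K).2 hb_sum)
    (fun n => by simpa only [add_right_comm] using h (n + K) (Nat.le_add_left K n))
  exact ⟨(summable_nat_add_iff K).1 h1, l, (tendsto_add_atTop_iff_nat K).1 h2⟩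

/-- If `A n / n` is summable, the limit of `A` can only be zero. -/
theorem eq_zero_of_tendsto_of_summable_div {A : ℕ → ℝ} {l : ℝ} (hA : ∀ n, 0 ≤ A n)
    (hl : Tendsto A atTop (nhds l)) (hs : Summable fun n : ℕ => A n / n) : l = 0 := by
  by_contra hne
  have hpos : 0 < l := lt_of_le_of_ne (ge_of_tendsto' hl hA) (Ne.symm hne)
  refine Real.not_summable_one_div_natCast ?_
  have hev : ∀ᶠ n in atTop, l / 2 ≤ A n :=
    (hl.eventually (lt_mem_nhds (half_lt_self hpos))).mono fun n hn => le_of_lt hn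
  refine Summable.of_norm_bounded_eventually_nat (hs.mul_left (2 / l)) ?_
  filter_upwards [hev] with n hn
  rw [Real.norm_of_nonneg (by positivity)]
  have : 1 ≤ 2 / l * A n := by
    rw [div_mul_eq_mul_div, le_div_iff₀ hpos]
    linarith
  calc (1 : ℝ) / n ≤ (2 / l * A n) / n := by gcongr
    _ = _ := by ring

theorem Summable.sq_of_nonneg {u : ℕ → ℝ} (hu : ∀ n, 0 ≤ u n) (h : Summable u) :
    Summable fun n => u n ^ 2 := by
  refine Summable.of_norm_bounded_eventually_nat h ?_
  filter_upwards [h.tendsto_atTop_zero.eventually (gt_mem_nhds one_pos)] with n hn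
  rw [Real.norm_of_nonneg (sq_nonneg _)]
  nlinarith [hu n]

theorem Summable.succ_pow_mul {u : ℕ → ℝ} (p : ℕ) (hu : ∀ n, 0 ≤ u n)
    (h : Summable fun n : ℕ => (n : ℝ) ^ p * u n) :
    Summable fun n : ℕ => ((n : ℝ) + 1) ^ p * u n := by
  refine Summable.of_norm_bounded_eventually_nat (h.mul_left (2 ^ p)) ?_
  filter_upwards [eventually_ge_atTop 1] with n hn
  have hn' : (1 : ℝ) ≤ n := by exact_mod_cast hn
  have := hu n
  rw [Real.norm_of_nonneg (by positivity), ← mul_assoc, ← mul_pow]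
  gcongr
  linarith

section Convex

variable {H : Type*} [NormedAddCommGroup H] [InnerProductSpace ℝ H] [CompleteSpace H]
  {f : H → ℝ} {f' : H → H}

theorem hasDerivAt_comp_add_smul (hdiff : ∀ z, HasGradientAt f (f' z) z) (y d : H) (t : ℝ) :
    HasDerivAt (fun t : ℝ => f (y + t • d)) (inner ℝ (f' (y + t • d)) d) t := by
  have h1 : HasDerivAt (fun t : ℝ => y + t • d) d t := by
    simpa using ((hasDerivAt_id t).smul_const d).const_add y
  simpa [Function.comp_def] using (hdiff (y + t • d)).hasFDerivAt.comp_hasDerivAt t h1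

theorem ConvexOn.add_inner_gradient_le (hconv : ConvexOn ℝ Set.univ f)
    (hdiff : ∀ z, HasGradientAt f (f' z) z) (y x : H) :
    f y + inner ℝ (f' y) (x - y) ≤ f x := by
  have hφ : ConvexOn ℝ Set.univ (fun t : ℝ => f (y + t • (x - y))) := by
    have := hconv.comp_affineMap (AffineMap.lineMap (k := ℝ) y x)
    refine this.congr ?_ |>.subset (by simp) convex_univ
    intro t _
    simp [AffineMap.lineMap_apply, add_comm]
  have := hφ.le_slope_of_hasDerivAt (Set.mem_univ 0) (Set.mem_univ 1) one_pos
    (hasDerivAt_comp_add_smul hdiff y (x - y) 0)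
  simp [slope] at this
  linarith

theorem ConvexOn.inner_gradient_sub_nonneg (hconv : ConvexOn ℝ Set.univ f)
    (hdiff : ∀ z, HasGradientAt f (f' z) z) (x y : H) :
    0 ≤ inner ℝ (f' x - f' y) (x - y) := by
  have h1 := hconv.add_inner_gradient_le hdiff x y
  have h2 := hconv.add_inner_gradient_le hdiff y x
  rw [← neg_sub x, inner_neg_right] at h1
  rw [inner_sub_left]
  linarith

theorem le_add_inner_gradient_add_sq {L : ℝ} (hdiff : ∀ z, HasGradientAt f (f' z) z)
    (hlip : ∀ z w, ‖f' z - f' w‖ ≤ L * ‖z - w‖) (y d : H) :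
    f (y + d) ≤ f y + inner ℝ (f' y) d + L / 2 * ‖d‖ ^ 2 := by
  set ψ : ℝ → ℝ := fun t => f (y + t • d) - t * inner ℝ (f' y) d - L / 2 * ‖d‖ ^ 2 * t ^ 2
  have hψ : ∀ t, HasDerivAt ψ
      (inner ℝ (f' (y + t • d)) d - inner ℝ (f' y) d - L / 2 * ‖d‖ ^ 2 * (2 * t)) t := by
    intro t
    have h1 := hasDerivAt_comp_add_smul hdiff y d t
    have h2 := (hasDerivAt_id t).mul_const (inner ℝ (f' y) d)
    have h3 := (hasDerivAt_pow 2 t).const_mul (L / 2 * ‖d‖ ^ 2)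
    exact ((h1.sub h2).sub h3).congr_deriv (by simp)
  have hanti : AntitoneOn ψ (Set.Icc 0 1) := by
    refine antitoneOn_of_deriv_nonpos (convex_Icc 0 1)
      (fun t _ => (hψ t).continuousAt.continuousWithinAt)
      (fun t _ => (hψ t).differentiableAt.differentiableWithinAt) fun t ht => ?_
    rw [interior_Icc] at ht
    rw [(hψ t).deriv, ← inner_sub_left]
    have h1 := real_inner_le_norm (f' (y + t • d) - f' y) d
    have h2 := hlip (y + t • d) y
    rw [add_sub_cancel_left, norm_smul, Real.norm_of_nonneg ht.1.le] at h2
    nlinarith [mul_le_mul_of_nonneg_right h2 (norm_nonneg d)]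
  have := hanti (Set.left_mem_Icc.2 zero_le_one) (Set.right_mem_Icc.2 zero_le_one) zero_le_one
  simp [ψ] at this
  linarith

theorem ConvexOn.add_inner_gradient_add_sq_le {L : ℝ} (hL : 0 < L)
    (hconv : ConvexOn ℝ Set.univ f) (hdiff : ∀ z, HasGradientAt f (f' z) z)
    (hlip : ∀ z w, ‖f' z - f' w‖ ≤ L * ‖z - w‖) (y x : H) :
    f y + inner ℝ (f' y) (x - y) + 1 / (2 * L) * ‖f' y - f' x‖ ^ 2 ≤ f x := by
  have h1 := hconv.add_inner_gradient_le hdiff y (x + (1 / L) • (f' y - f' x))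
  have h2 := le_add_inner_gradient_add_sq hdiff hlip x ((1 / L) • (f' y - f' x))
  have h3 : inner ℝ (f' y) (f' y - f' x) - inner ℝ (f' x) (f' y - f' x)
      = ‖f' y - f' x‖ ^ 2 := by
    rw [← inner_sub_left, real_inner_self_eq_norm_sq]
  rw [add_sub_right_comm, inner_add_right, inner_smul_right] at h1
  rw [inner_smul_right, norm_smul, Real.norm_of_nonneg (by positivity), mul_pow] at h2
  have h4 : L / 2 * ((1 / L) ^ 2 * ‖f' y - f' x‖ ^ 2) = 1 / (2 * L) * ‖f' y - f' x‖ ^ 2 := by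
    field_simp
  have h5 : 1 / L * inner ℝ (f' y) (f' y - f' x) - 1 / L * inner ℝ (f' x) (f' y - f' x)
      = 2 * (1 / (2 * L) * ‖f' y - f' x‖ ^ 2) := by
    rw [← mul_sub, h3]
    field_simp
  linarith

/-- Decrease of `f` along a gradient step from `y` with error `N`, compared with any point `x`. -/
theorem ConvexOn.inexact_gradient_step_le {L sc : ℝ} (hL : 0 < L) (hsc : 0 < sc)
    (hscL : sc ≤ 1 / L)
    (hconv : ConvexOn ℝ Set.univ f) (hdiff : ∀ z, HasGradientAt f (f' z) z)
    (hlip : ∀ z w, ‖f' z - f' w‖ ≤ L * ‖z - w‖) (y x N : H) :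
    f (y - sc • (f' y + N)) ≤ f x + inner ℝ (f' y) (y - x) - sc / 2 * ‖f' y - f' x‖ ^ 2
      - sc / 2 * ‖f' y‖ ^ 2 + sc / 2 * ‖N‖ ^ 2 := by
  have h1 := hconv.add_inner_gradient_add_sq_le hL hdiff hlip y x
  have h2 := le_add_inner_gradient_add_sq hdiff hlip y (-(sc • (f' y + N)))
  rw [← sub_eq_add_neg, inner_neg_right, norm_neg, inner_smul_right, norm_smul, mul_pow,
    Real.norm_of_nonneg hsc.le, norm_add_sq_real, inner_add_right,
    real_inner_self_eq_norm_sq] at h2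
  rw [← neg_sub y x, inner_neg_right] at h1
  have hLs : sc * L ≤ 1 := by
    rwa [le_div_iff₀ hL] at hscL
  have h3 : sc / 2 * ‖f' y - f' x‖ ^ 2 ≤ 1 / (2 * L) * ‖f' y - f' x‖ ^ 2 := by
    have : sc / 2 ≤ 1 / (2 * L) := by
      rw [div_le_div_iff₀ two_pos (by positivity)]
      linarith
    gcongr
  have h4 : 0 ≤ ‖f' y‖ ^ 2 + 2 * inner ℝ (f' y) N + ‖N‖ ^ 2 := by
    rw [← norm_add_sq_real]
    positivity
  have h5 : L / 2 * (sc ^ 2 * (‖f' y‖ ^ 2 + 2 * inner ℝ (f' y) N + ‖N‖ ^ 2)) ≤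
      sc / 2 * (‖f' y‖ ^ 2 + 2 * inner ℝ (f' y) N + ‖N‖ ^ 2) := by
    rw [← mul_assoc]
    gcongr
    nlinarith
  linarith

end Convex

section Steps

variable {H : Type*} [NormedAddCommGroup H] [InnerProductSpace ℝ H]

theorem abs_inner_le_mul_add_div (v w : H) {ε : ℝ} (hε : 0 < ε) :
    |inner ℝ v w| ≤ ε * ‖v‖ ^ 2 + ‖w‖ ^ 2 / (4 * ε) := by
  refine (abs_real_inner_le_norm v w).trans ?_
  rw [← sub_nonneg]
  have : ε * ‖v‖ ^ 2 + ‖w‖ ^ 2 / (4 * ε) - ‖v‖ * ‖w‖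
      = (2 * ε * ‖v‖ - ‖w‖) ^ 2 / (4 * ε) := by
    field_simp
    ring
  rw [this]
  positivity

/-- One-step decrease of the Lyapunov function `t² F + ‖u‖² / (2 sc)`. -/
theorem lyapunov_step {sc b t F₀ F₁ : ℝ} {X Y u g h M N : H} (hsc : 0 < sc) (hb : 0 < b)
    (hb1 : b ≤ 1) (ht : 8 / b ≤ t)
    (hu : u = X + t • (Y - X) + (b * sc * t) • (g + M))
    (h₁ : F₁ ≤ F₀ + inner ℝ h (Y - X) - sc / 2 * ‖h - g‖ ^ 2 - sc / 2 * ‖h‖ ^ 2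
      + sc / 2 * ‖N‖ ^ 2)
    (h₂ : F₁ ≤ inner ℝ h Y - sc * ‖h‖ ^ 2 + sc / 2 * ‖N‖ ^ 2) :
    t ^ 2 * F₁ + ‖u - (sc * t) • (h + N)‖ ^ 2 / (2 * sc)
        + b / 8 * sc * t ^ 2 * (‖h‖ ^ 2 + ‖g‖ ^ 2)
      ≤ (t ^ 2 - t) * F₀ + ‖u‖ ^ 2 / (2 * sc) + t * ‖N‖ * ‖u‖
        + sc * t ^ 2 * ((2 / b + 1) * ‖N‖ ^ 2 + 2 * b * ‖M‖ ^ 2) := by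
  have ht8 : 8 ≤ t * b := by rwa [div_le_iff₀ hb] at ht
  have ht0 : 0 < t := lt_of_lt_of_le (by positivity) ht
  have ht1 : 1 ≤ t := by nlinarith
  have hexp : ‖u - (sc * t) • (h + N)‖ ^ 2 / (2 * sc) = ‖u‖ ^ 2 / (2 * sc)
      - t * (inner ℝ u h + inner ℝ u N)
      + sc * t ^ 2 / 2 * (‖h‖ ^ 2 + 2 * inner ℝ h N + ‖N‖ ^ 2) := by
    rw [norm_sub_sq_real, inner_smul_right, norm_smul, Real.norm_of_nonneg (by positivity),
      mul_pow, norm_add_sq_real, inner_add_right]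
    field_simp
  have huh : inner ℝ u h = inner ℝ h X + t * (inner ℝ h Y - inner ℝ h X)
      + b * sc * t * (inner ℝ h g + inner ℝ h M) := by
    rw [real_inner_comm, hu]
    simp only [inner_add_right, inner_smul_right, inner_sub_right]
  have hN : -(‖u‖ * ‖N‖) ≤ inner ℝ u N := neg_le_of_abs_le (abs_real_inner_le_norm u N)
  rw [hexp, huh]
  rw [inner_sub_right, norm_sub_sq_real] at h₁
  have hhN : inner ℝ h N ≤ b / 8 * ‖h‖ ^ 2 + 2 / b * ‖N‖ ^ 2 := by
    refine (le_abs_self _).trans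
      ((abs_inner_le_mul_add_div h N (by positivity : 0 < b / 8)).trans_eq ?_)
    field_simp
    ring
  have hhM : -inner ℝ h M ≤ 1 / 8 * ‖h‖ ^ 2 + 2 * ‖M‖ ^ 2 := by
    refine (neg_le_abs _).trans
      ((abs_inner_le_mul_add_div h M (by norm_num : (0 : ℝ) < 1 / 8)).trans_eq ?_)
    ring
  have hhg : |inner ℝ h g| ≤ 1 / 2 * ‖h‖ ^ 2 + ‖g‖ ^ 2 / 2 :=
    (abs_inner_le_mul_add_div h g (by norm_num : (0 : ℝ) < 1 / 2)).trans_eq (by ring)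
  obtain ⟨hg1, hg2⟩ := abs_le.1 hhg
  have e1 := mul_le_mul_of_nonneg_left h₁ (by nlinarith : 0 ≤ t ^ 2 - t)
  have e2 := mul_le_mul_of_nonneg_left h₂ ht0.le
  have e3 := mul_le_mul_of_nonneg_left hhN (by positivity : 0 ≤ sc * t ^ 2)
  have e4 := mul_le_mul_of_nonneg_left hhM (by positivity : 0 ≤ b * sc * t ^ 2)
  have e5 := mul_le_mul_of_nonneg_left hg2 (mul_nonneg (by positivity) (sub_nonneg.2 hb1) :
    0 ≤ sc * t ^ 2 * (1 - b))
  have e6 := mul_le_mul_of_nonneg_left hg1 (by positivity : 0 ≤ sc * t)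
  have e7 := mul_le_mul_of_nonneg_left hN ht0.le
  have e8 : 0 ≤ sc * t * (t * b - 8) * (‖h‖ ^ 2 + ‖g‖ ^ 2) :=
    mul_nonneg (mul_nonneg (by positivity) (by linarith)) (by positivity)
  have e9 : 0 ≤ sc * t * ‖h‖ ^ 2 := by positivity
  have e10 : 0 ≤ b * sc * t ^ 2 * ‖g‖ ^ 2 := by positivity
  linarith

/-- One-step estimate for the velocity energy `2 sc F + ‖d‖²`. -/
theorem velocity_step {sc c a e F₀ F₁ : ℝ} {d p g₀ g₁ h M₀ M₁ N : H} (hsc : 0 < sc)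
    (hc : 0 < c) (ha0 : 0 ≤ a) (ha1 : a ≤ 1) (he0 : 0 ≤ e) (he1 : e ≤ 1)
    (hp : p = a • d - c • (g₁ + M₁) + (c * (1 - e)) • (g₀ + M₀))
    (h₁ : F₁ ≤ F₀ + inner ℝ h p - sc / 2 * ‖h - g₁‖ ^ 2 - sc / 2 * ‖h‖ ^ 2
      + sc / 2 * ‖N‖ ^ 2)
    (hmono : 0 ≤ inner ℝ d (g₁ - g₀)) :
    2 * sc * F₁ + ‖p - sc • (h + N)‖ ^ 2 ≤ 2 * sc * F₀ + a ^ 2 * ‖d‖ ^ 2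
      + 2 * ‖d‖ * (c * (‖M₁‖ + ‖M₀‖) + sc * ‖N‖) + 2 * (c * e) * ‖g₀‖ * ‖d‖
      + (8 * c ^ 2 * (‖g₁‖ ^ 2 + ‖M₁‖ ^ 2 + ‖g₀‖ ^ 2 + ‖M₀‖ ^ 2)
        + 2 * sc ^ 2 * ‖h‖ ^ 2 + 4 * sc ^ 2 * ‖N‖ ^ 2) := by
  obtain ⟨q, hq⟩ : ∃ q, q = c • (g₁ + M₁) - (c * (1 - e)) • (g₀ + M₀) := ⟨_, rfl⟩
  have hpq : p = a • d - q := by rw [hp, hq]; abel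
  have hqd : inner ℝ d q = c * inner ℝ d (g₁ - g₀) + c * inner ℝ d M₁
      - c * (1 - e) * inner ℝ d M₀ + c * e * inner ℝ d g₀ := by
    rw [hq]
    simp only [inner_add_right, inner_smul_right, inner_sub_right]
    ring
  have hqn : ‖q‖ ≤ c * (‖g₁‖ + ‖M₁‖ + ‖g₀‖ + ‖M₀‖) := by
    have h0 : 0 ≤ 1 - e := by linarith
    calc ‖q‖ ≤ ‖c • (g₁ + M₁)‖ + ‖(c * (1 - e)) • (g₀ + M₀)‖ := by rw [hq]; exact norm_sub_le _ _
      _ = c * ‖g₁ + M₁‖ + c * (1 - e) * ‖g₀ + M₀‖ := by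
        rw [norm_smul, norm_smul, Real.norm_of_nonneg hc.le, Real.norm_of_nonneg (by positivity)]
      _ ≤ c * (‖g₁‖ + ‖M₁‖) + c * 1 * (‖g₀‖ + ‖M₀‖) := by
        gcongr
        · exact norm_add_le _ _
        · linarith
        · exact norm_add_le _ _
      _ = _ := by ring
  have hqsq : ‖q‖ ^ 2 ≤ 4 * c ^ 2 * (‖g₁‖ ^ 2 + ‖M₁‖ ^ 2 + ‖g₀‖ ^ 2 + ‖M₀‖ ^ 2) := by
    have h4 : (‖g₁‖ + ‖M₁‖ + ‖g₀‖ + ‖M₀‖) ^ 2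
        ≤ 4 * (‖g₁‖ ^ 2 + ‖M₁‖ ^ 2 + ‖g₀‖ ^ 2 + ‖M₀‖ ^ 2) := by
      linarith [sq_nonneg (‖g₁‖ - ‖M₁‖), sq_nonneg (‖g₁‖ - ‖g₀‖), sq_nonneg (‖g₁‖ - ‖M₀‖),
        sq_nonneg (‖M₁‖ - ‖g₀‖), sq_nonneg (‖M₁‖ - ‖M₀‖), sq_nonneg (‖g₀‖ - ‖M₀‖)]
    calc ‖q‖ ^ 2 ≤ (c * (‖g₁‖ + ‖M₁‖ + ‖g₀‖ + ‖M₀‖)) ^ 2 := by gcongr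
      _ = c ^ 2 * (‖g₁‖ + ‖M₁‖ + ‖g₀‖ + ‖M₀‖) ^ 2 := by ring
      _ ≤ c ^ 2 * (4 * (‖g₁‖ ^ 2 + ‖M₁‖ ^ 2 + ‖g₀‖ ^ 2 + ‖M₀‖ ^ 2)) := by gcongr
      _ = _ := by ring
  set T := ‖d‖ * (c * (‖M₁‖ + ‖M₀‖)) + c * e * ‖g₀‖ * ‖d‖ with hT
  have hT0 : 0 ≤ T := by positivity
  have hdq : -T ≤ inner ℝ d q := by
    have i1 := (abs_le.1 (abs_real_inner_le_norm d M₁)).1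
    have i2 := (abs_le.1 (abs_real_inner_le_norm d M₀)).2
    have i3 := (abs_le.1 (abs_real_inner_le_norm d g₀)).1
    have j1 := mul_le_mul_of_nonneg_left i1 hc.le
    have j2 := mul_le_mul_of_nonneg_left i2 (mul_nonneg hc.le (by linarith) : 0 ≤ c * (1 - e))
    have j3 := mul_le_mul_of_nonneg_left i3 (by positivity : 0 ≤ c * e)
    have j4 : 0 ≤ c * e * (‖d‖ * ‖M₀‖) := by positivity
    have j5 := mul_nonneg hc.le hmono
    rw [hqd, hT]
    linarith
  have hadq : -T ≤ a * inner ℝ d q := by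
    have i1 := mul_le_mul_of_nonneg_left hdq ha0
    have i2 := mul_le_mul_of_nonneg_right ha1 hT0
    linarith
  have hpsq : ‖p‖ ^ 2 = a ^ 2 * ‖d‖ ^ 2 - 2 * (a * inner ℝ d q) + ‖q‖ ^ 2 := by
    rw [hpq, norm_sub_sq_real, inner_smul_left, norm_smul, mul_pow, Real.norm_of_nonneg ha0]
    rfl
  have hpN : inner ℝ p N = a * inner ℝ d N - inner ℝ q N := by
    rw [hpq, inner_sub_left, inner_smul_left]
    rfl
  have hdN : -(‖d‖ * ‖N‖) ≤ a * inner ℝ d N := by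
    have i1 := (abs_le.1 (abs_real_inner_le_norm d N)).1
    have i2 := mul_le_mul_of_nonneg_left i1 ha0
    have i3 := mul_le_mul_of_nonneg_right ha1 (by positivity : 0 ≤ ‖d‖ * ‖N‖)
    linarith
  have hqN : 2 * sc * inner ℝ q N ≤ ‖q‖ ^ 2 + sc ^ 2 * ‖N‖ ^ 2 := by
    have i1 := mul_le_mul_of_nonneg_left (real_inner_le_norm q N) (by positivity : 0 ≤ 2 * sc)
    linarith [sq_nonneg (‖q‖ - sc * ‖N‖)]
  have hhN : 2 * inner ℝ h N ≤ ‖h‖ ^ 2 + ‖N‖ ^ 2 := by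
    nlinarith [real_inner_le_norm h N, sq_nonneg (‖h‖ - ‖N‖)]
  have hexp : ‖p - sc • (h + N)‖ ^ 2 = ‖p‖ ^ 2 - 2 * (sc * (inner ℝ h p + inner ℝ p N))
      + sc ^ 2 * (‖h‖ ^ 2 + 2 * inner ℝ h N + ‖N‖ ^ 2) := by
    rw [norm_sub_sq_real, inner_smul_right, norm_smul, Real.norm_of_nonneg hsc.le, mul_pow,
      norm_add_sq_real, inner_add_right, real_inner_comm]
  rw [hexp, hpsq, hpN]
  have e1 := mul_le_mul_of_nonneg_left h₁ (by positivity : 0 ≤ 2 * sc)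
  have e2 : 0 ≤ sc ^ 2 * ‖h - g₁‖ ^ 2 := by positivity
  have e3 := mul_le_mul_of_nonneg_left hhN (sq_nonneg sc)
  have e4 := mul_le_mul_of_nonneg_left hdN (by positivity : 0 ≤ 2 * sc)
  have e5 : 0 ≤ sc ^ 2 * ‖h‖ ^ 2 := by positivity
  linarith

end Steps

/-- Multiplying the velocity energy estimate at time `κ` by `(κ + 1)²`. -/
theorem weighted_velocity_step {α κ σ c F₀ V₁ δ ρ γ Q : ℝ} (hα : 3 < α) (hκ : α ≤ κ)
    (hσ : 0 < σ) (hF : 0 ≤ F₀) (hc : 0 < c) (hδ : 0 ≤ δ) (hρ : 0 ≤ ρ)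
    (hγ : 0 ≤ γ) (hQ : 0 ≤ Q)
    (h : V₁ ≤ 2 * σ * F₀ + (1 - α / κ) ^ 2 * δ ^ 2 + 2 * δ * ρ
      + 2 * (c * (1 / κ)) * γ * δ + Q) :
    (κ + 1) ^ 2 * V₁ + κ * δ ^ 2 ≤ (1 + 4 * κ * ρ) * (κ ^ 2 * (2 * σ * F₀ + δ ^ 2))
      + (6 * σ * (κ * F₀) + 4 * κ * ρ + 16 * c ^ 2 * (κ * γ ^ 2) + 4 * (κ ^ 2 * Q)) := by
  have hκ3 : 3 < κ := hα.trans_le hκ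
  have hκ0 : 0 < κ := by linarith
  have hsq : (κ + 1) ^ 2 ≤ 4 * κ ^ 2 := by nlinarith
  have e0 := mul_le_mul_of_nonneg_left h (sq_nonneg (κ + 1))
  have e1 : (κ + 1) ^ 2 * (1 - α / κ) ^ 2 ≤ κ ^ 2 - 2 * κ := by
    have h1 : (κ + 1) * (1 - α / κ) = κ + 1 - α - α / κ := by field_simp; ring
    have h2 : 0 ≤ 1 - α / κ := by
      rw [sub_nonneg, div_le_one hκ0]
      exact hκ
    have h3 : 0 ≤ α / κ := by positivity
    have h4 : 0 ≤ (κ + 1) * (1 - α / κ) := by positivity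
    have h5 : (κ + 1) * (1 - α / κ) ≤ κ - 2 := by linarith
    calc (κ + 1) ^ 2 * (1 - α / κ) ^ 2 = ((κ + 1) * (1 - α / κ)) ^ 2 := by ring
      _ ≤ (κ - 2) ^ 2 := by gcongr
      _ ≤ _ := by nlinarith
  have e2 := mul_le_mul_of_nonneg_right e1 (sq_nonneg δ)
  have e3 := mul_le_mul_of_nonneg_right hsq (by positivity : 0 ≤ 2 * δ * ρ)
  have e4 : 0 ≤ 4 * κ * ρ * (κ * δ - 1) ^ 2 := by positivity
  have e5 := mul_le_mul_of_nonneg_right hsq (by positivity : 0 ≤ 2 * (c * (1 / κ)) * γ * δ)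
  have e5' : 4 * κ ^ 2 * (2 * (c * (1 / κ)) * γ * δ) = 8 * κ * c * γ * δ := by field_simp; ring
  have e6 : 0 ≤ κ * (δ - 4 * c * γ) ^ 2 := by positivity
  have e7 := mul_le_mul_of_nonneg_right hsq hQ
  have e8 : (κ + 1) ^ 2 * (2 * σ * F₀) ≤ κ ^ 2 * (2 * σ * F₀) + 6 * σ * (κ * F₀) := by
    have : 0 ≤ 2 * σ * F₀ := by positivity
    nlinarith
  have e9 : 0 ≤ 4 * κ * ρ * (κ ^ 2 * (2 * σ * F₀)) := by positivity
  rw [e5'] at e5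
  linarith

theorem Summable.pow_mul_pred {u : ℕ → ℝ} (p : ℕ) (hu : ∀ n, 0 ≤ u n)
    (h : Summable fun n : ℕ => (n : ℝ) ^ p * u n) :
    Summable fun n : ℕ => (n : ℝ) ^ p * u (n - 1) := by
  rw [← summable_nat_add_iff 1]
  simpa using h.succ_pow_mul p hu

theorem le_one_add_of_eq_add_sq_div {A B : ℝ} {σ v : ℝ} (hσ : 0 < σ) (hB : 0 ≤ B)
    (hA : A = B + v ^ 2 / (2 * σ)) : v ≤ 1 + 2 * σ * A := by
  have : 2 * σ * A = 2 * σ * B + v ^ 2 := by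
    rw [hA]
    field_simp
  have : 0 ≤ 2 * σ * B := by positivity
  nlinarith [sq_nonneg (v - 1)]

section Sequences

variable {H : Type*} [NormedAddCommGroup H]

theorem summable_sq_mul_norm_sq {M : ℕ → H} (hM : Summable fun k : ℕ => (k : ℝ) * ‖M k‖) :
    Summable fun k : ℕ => (k : ℝ) ^ 2 * ‖M k‖ ^ 2 :=
  (hM.sq_of_nonneg fun k => by positivity).congr fun k => by ring

variable [InnerProductSpace ℝ H]

/-- Summability of the dissipation terms, from the Lyapunov function `t² F + ‖u‖² / (2 sc)`
along the inertial iteration with gradients `g n` at `x n` and `h n` at `y n`. -/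
theorem summable_gap_and_gradients {α sc b c : ℝ} (hα : 3 < α) (hsc_pos : 0 < sc)
    (hb0 : 0 < b) (hb1 : b ≤ 1) (hc : c = b * sc) {x y g h M N : ℕ → H} {xstar : H}
    {F : ℕ → ℝ} (hF : ∀ n, 0 ≤ F n)
    (hy : ∀ n, 2 ≤ n → y n = x n + (1 - α / (n : ℝ)) • (x n - x (n - 1)) - c • (g n + M n)
      + (c * (1 - 1 / (n : ℝ))) • (g (n - 1) + M (n - 1)))
    (hx : ∀ n, 1 ≤ n → x (n + 1) = y n - sc • (h n + N n))
    (hstep : ∀ n, 1 ≤ n → F (n + 1) ≤ F n + inner ℝ (h n) (y n - x n)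
      - sc / 2 * ‖h n - g n‖ ^ 2 - sc / 2 * ‖h n‖ ^ 2 + sc / 2 * ‖N n‖ ^ 2)
    (hstep_min : ∀ n, 1 ≤ n → F (n + 1) ≤ inner ℝ (h n) (y n - xstar)
      - sc * ‖h n‖ ^ 2 + sc / 2 * ‖N n‖ ^ 2)
    (hM1 : Summable fun n : ℕ => (n : ℝ) * ‖M n‖)
    (hN1 : Summable fun n : ℕ => (n : ℝ) * ‖N n‖) :
    (Summable fun n : ℕ => (n : ℝ) * F n) ∧
      Summable fun n : ℕ => (n : ℝ) ^ 2 * (‖h n‖ ^ 2 + ‖g n‖ ^ 2) := by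
  have hα1 : 0 < α - 1 := by linarith
  have hα1' : α - 1 ≠ 0 := hα1.ne'
  have hα3 : 0 < α - 3 := by linarith
  have hM2 := summable_sq_mul_norm_sq hM1
  have hN2 := summable_sq_mul_norm_sq hN1
  have hlyap : Summable fun n : ℕ => (α - 3) / (α - 1) * ((n : ℝ) / (α - 1)) * F n
      + b / 8 * sc * ((n : ℝ) / (α - 1)) ^ 2 * (‖h n‖ ^ 2 + ‖g n‖ ^ 2) := by
    set u : ℕ → H := fun n => x (n - 1) - xstar + (((n : ℝ) - 1) / (α - 1)) •
      (x n - x (n - 1) + c • (g (n - 1) + M (n - 1))) with hudef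
    set E : ℕ → ℝ := fun n => (((n : ℝ) - 1) / (α - 1)) ^ 2 * F n + ‖u n‖ ^ 2 / (2 * sc) with hE
    set e : ℕ → ℝ := fun n => (n : ℝ) / (α - 1) * ‖N n‖
      + sc * ((n : ℝ) / (α - 1)) ^ 2 * ((2 / b + 1) * ‖N n‖ ^ 2 + 2 * b * ‖M n‖ ^ 2) with he
    obtain ⟨K, hK⟩ := exists_nat_ge (8 / b * (α - 1))
    refine (summable_and_exists_tendsto_of_eventually_quasi_descent (A := E)
      (a := fun n => 2 * sc * ((n : ℝ) / (α - 1) * ‖N n‖)) (b := e) (max 2 K)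
      (fun n => ?_) (fun n => ?_) (fun n => ?_) (fun n => ?_) ?_ ?_ fun n hn => ?_).1
    · have := hF n
      simp only [hE]
      positivity
    · have := hF n
      positivity
    · positivity
    · simp only [he]
      positivity
    · exact (hN1.mul_left (2 * sc / (α - 1))).congr fun n => by ring
    · refine ((hN1.mul_left (1 / (α - 1))).add ((hN2.mul_left
        (sc * (1 / (α - 1)) ^ 2 * (2 / b + 1))).add (hM2.mul_left
        (sc * (1 / (α - 1)) ^ 2 * (2 * b))))).congr fun n => ?_
      simp only [he]
      ring
    · have hn2 : 2 ≤ n := (le_max_left _ _).trans hn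
      have hnK : (K : ℝ) ≤ n := by exact_mod_cast (le_max_right _ _).trans hn
      have hn0 : (n : ℝ) ≠ 0 := by positivity
      obtain ⟨t, ht⟩ : ∃ t, t = (n : ℝ) / (α - 1) := ⟨_, rfl⟩
      obtain ⟨t', ht'⟩ : ∃ t', t' = ((n : ℝ) - 1) / (α - 1) := ⟨_, rfl⟩
      have ht8 : 8 / b ≤ t := by
        rw [ht, le_div_iff₀ hα1]
        linarith
      have hte : t' = t - 1 / (α - 1) := by rw [ht, ht']; ring
      have hty : t • (y n - x n) = (t' - 1) • (x n - x (n - 1))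
          - (c * t) • (g n + M n) + (c * t') • (g (n - 1) + M (n - 1)) := by
        have e1 : t * (1 - α / n) = t' - 1 := by
          rw [ht, ht']
          field_simp
          ring
        have e2 : t * (c * (1 - 1 / n)) = c * t' := by
          rw [ht, ht']
          field_simp
        rw [← e1, ← e2, hy n hn2]
        module
      have hu : u n = (x n - xstar) + t • ((y n - xstar) - (x n - xstar))
          + (b * sc * t) • (g n + M n) := by
        rw [sub_sub_sub_cancel_right, hty]
        simp only [hudef, ← ht', ← hc]
        module
      have hu' : u (n + 1) = u n - (sc * t) • (h n + N n) := by
        rw [hu, sub_sub_sub_cancel_right]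
        simp only [hudef, Nat.add_sub_cancel, Nat.cast_add, Nat.cast_one, add_sub_cancel_right,
          ← ht, ← hc]
        rw [hx n (by omega)]
        module
      have key := lyapunov_step (F₀ := F n) (F₁ := F (n + 1)) (M := M n) (N := N n)
        (h := h n) (g := g n) hsc_pos hb0 hb1 ht8 hu
        (by rw [sub_sub_sub_cancel_right]; exact hstep n (by omega))
        (hstep_min n (by omega))
      rw [← hu'] at key
      have hEn : E n = t' ^ 2 * F n + ‖u n‖ ^ 2 / (2 * sc) := by rw [ht']
      have hEn' : E (n + 1) = t ^ 2 * F (n + 1) + ‖u (n + 1)‖ ^ 2 / (2 * sc) := by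
        simp only [hE, Nat.cast_add, Nat.cast_one, add_sub_cancel_right, ← ht]
      have hun := le_one_add_of_eq_add_sq_div hsc_pos (mul_nonneg (sq_nonneg t') (hF n)) hEn
      have ht0 : 0 ≤ t := by rw [ht]; positivity
      have hun' := mul_le_mul_of_nonneg_left hun (mul_nonneg ht0 (norm_nonneg (N n)))
      have hcoef : (t ^ 2 - t) * F n + (α - 3) / (α - 1) * t * F n ≤ t' ^ 2 * F n := by
        rw [← add_mul]
        refine mul_le_mul_of_nonneg_right ?_ (hF n)
        have : (α - 3) / (α - 1) = 1 - 2 * (1 / (α - 1)) := by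
          field_simp
          ring
        rw [hte, this]
        linarith [sq_nonneg (1 / (α - 1))]
      simp only [he, ← ht]
      rw [hEn']
      linarith
  constructor
  · refine (hlyap.mul_left ((α - 1) ^ 2 / (α - 3))).of_nonneg_of_le
      (fun n => mul_nonneg n.cast_nonneg (hF n)) fun n => ?_
    have h1 : (n : ℝ) * F n = (α - 1) ^ 2 / (α - 3) *
        ((α - 3) / (α - 1) * ((n : ℝ) / (α - 1)) * F n) := by field_simp
    rw [h1]
    gcongr
    exact le_add_of_nonneg_right (by positivity)
  · refine (hlyap.mul_left ((α - 1) ^ 2 * 8 / (b * sc))).of_nonneg_of_le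
      (fun n => by positivity) fun n => ?_
    have h1 : (n : ℝ) ^ 2 * (‖h n‖ ^ 2 + ‖g n‖ ^ 2) = (α - 1) ^ 2 * 8 / (b * sc) *
        (b / 8 * sc * ((n : ℝ) / (α - 1)) ^ 2 * (‖h n‖ ^ 2 + ‖g n‖ ^ 2)) := by
      field_simp
    have := hF n
    rw [h1]
    gcongr
    exact le_add_of_nonneg_left (by positivity)

set_option maxHeartbeats 800000 in
/-- The velocity energy `n² (2 sc F n + ‖x n - x (n - 1)‖²)` tends to zero. -/
theorem tendsto_velocity_energy_zero {α sc c : ℝ} (hα : 3 < α) (hsc_pos : 0 < sc)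
    (hc0 : 0 < c) {x y g h M N : ℕ → H} {F : ℕ → ℝ} (hF : ∀ n, 0 ≤ F n)
    (hy : ∀ n, 2 ≤ n → y n = x n + (1 - α / (n : ℝ)) • (x n - x (n - 1)) - c • (g n + M n)
      + (c * (1 - 1 / (n : ℝ))) • (g (n - 1) + M (n - 1)))
    (hx : ∀ n, 1 ≤ n → x (n + 1) = y n - sc • (h n + N n))
    (hstep : ∀ n, 1 ≤ n → F (n + 1) ≤ F n + inner ℝ (h n) (y n - x n)
      - sc / 2 * ‖h n - g n‖ ^ 2 - sc / 2 * ‖h n‖ ^ 2 + sc / 2 * ‖N n‖ ^ 2)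
    (hmono : ∀ n, 0 ≤ inner ℝ (x n - x (n - 1)) (g n - g (n - 1)))
    (hM1 : Summable fun n : ℕ => (n : ℝ) * ‖M n‖)
    (hN1 : Summable fun n : ℕ => (n : ℝ) * ‖N n‖)
    (hF1 : Summable fun n : ℕ => (n : ℝ) * F n)
    (hgh : Summable fun n : ℕ => (n : ℝ) ^ 2 * (‖h n‖ ^ 2 + ‖g n‖ ^ 2)) :
    Tendsto (fun n : ℕ => (n : ℝ) ^ 2 * (2 * sc * F n + ‖x n - x (n - 1)‖ ^ 2)) atTop
      (nhds 0) := by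
  have hM2 := summable_sq_mul_norm_sq hM1
  have hN2 := summable_sq_mul_norm_sq hN1
  have hh2 : Summable fun n : ℕ => (n : ℝ) ^ 2 * ‖h n‖ ^ 2 :=
    hgh.of_nonneg_of_le (fun n => by positivity) fun n => by
      gcongr
      exact le_add_of_nonneg_right (by positivity)
  have hg2 : Summable fun n : ℕ => (n : ℝ) ^ 2 * ‖g n‖ ^ 2 :=
    hgh.of_nonneg_of_le (fun n => by positivity) fun n => by
      gcongr
      exact le_add_of_nonneg_left (by positivity)
  have hg2' : Summable fun n : ℕ => (n : ℝ) ^ 2 * ‖g (n - 1)‖ ^ 2 :=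
    hg2.pow_mul_pred 2 fun n => by positivity
  have hM2' : Summable fun n : ℕ => (n : ℝ) ^ 2 * ‖M (n - 1)‖ ^ 2 :=
    hM2.pow_mul_pred 2 fun n => by positivity
  have hM1' : Summable fun n : ℕ => (n : ℝ) * ‖M (n - 1)‖ := by
    simpa using Summable.pow_mul_pred (u := fun n => ‖M n‖) 1 (fun n => norm_nonneg _)
      (by simpa using hM1)
  have hg1' : Summable fun n : ℕ => (n : ℝ) * ‖g (n - 1)‖ ^ 2 := by
    refine hg2'.of_nonneg_of_le (fun n => by positivity) fun n => ?_
    gcongr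
    exact_mod_cast Nat.le_self_pow two_ne_zero n
  set d : ℕ → H := fun n => x n - x (n - 1) with hd
  set ρ : ℕ → ℝ := fun n => c * (‖M n‖ + ‖M (n - 1)‖) + sc * ‖N n‖ with hρ
  set Q : ℕ → ℝ := fun n => 8 * c ^ 2 * (‖g n‖ ^ 2 + ‖M n‖ ^ 2 + ‖g (n - 1)‖ ^ 2
    + ‖M (n - 1)‖ ^ 2) + 2 * sc ^ 2 * ‖h n‖ ^ 2 + 4 * sc ^ 2 * ‖N n‖ ^ 2 with hQ
  have hρ0 : ∀ n, 0 ≤ ρ n := fun n => by positivity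
  have hQ0 : ∀ n, 0 ≤ Q n := fun n => by positivity
  have hρ1 : Summable fun n : ℕ => (n : ℝ) * ρ n :=
    (((hM1.add hM1').mul_left c).add (hN1.mul_left sc)).congr fun n => by
      simp only [hρ]
      ring
  have hQ2 : Summable fun n : ℕ => (n : ℝ) ^ 2 * Q n :=
    (((((hg2.add hM2).add hg2').add hM2').mul_left (8 * c ^ 2)).add
      (hh2.mul_left (2 * sc ^ 2))).add (hN2.mul_left (4 * sc ^ 2)) |>.congr fun n => by
      simp only [hQ]
      ring
  set A : ℕ → ℝ := fun n => (n : ℝ) ^ 2 * (2 * sc * F n + ‖d n‖ ^ 2) with hA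
  have hA0 : ∀ n, 0 ≤ A n := fun n => by
    have := hF n
    simp only [hA]
    positivity
  obtain ⟨K, hK⟩ := exists_nat_ge α
  obtain ⟨hdsum, l, hl⟩ := summable_and_exists_tendsto_of_eventually_quasi_descent (A := A)
    (D := fun n : ℕ => (n : ℝ) * ‖d n‖ ^ 2) (a := fun n : ℕ => 4 * n * ρ n)
    (b := fun n : ℕ => 6 * sc * (n * F n) + 4 * n * ρ n
      + 16 * c ^ 2 * (n * ‖g (n - 1)‖ ^ 2) + 4 * ((n : ℝ) ^ 2 * Q n)) (max 2 K)
    hA0 (fun n => by positivity) (fun n => mul_nonneg (by positivity) (hρ0 n))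
    (fun n => by
      have := hF n
      have := hρ0 n
      have := hQ0 n
      positivity)
    ((hρ1.mul_left 4).congr fun n => by ring)
    ((((hF1.mul_left (6 * sc)).add (hρ1.mul_left 4)).add (hg1'.mul_left (16 * c ^ 2))).add
      (hQ2.mul_left 4) |>.congr fun n => by ring)
    (fun n hn => by
      have hn2 : 2 ≤ n := (le_max_left _ _).trans hn
      have hnK : (K : ℝ) ≤ n := by exact_mod_cast (le_max_right _ _).trans hn
      have hnα : α ≤ n := hK.trans hnK
      have hn0 : (0 : ℝ) < n := by positivity
      have ha0 : 0 ≤ 1 - α / n := by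
        rw [sub_nonneg, div_le_one hn0]
        exact hnα
      have ha1 : 1 - α / n ≤ 1 := by
        have : 0 ≤ α / n := by positivity
        linarith
      have he1 : 1 / (n : ℝ) ≤ 1 := by
        rw [div_le_one hn0]
        linarith
      have key := velocity_step (F₀ := F n) (F₁ := F (n + 1)) (d := d n) (p := y n - x n)
        (g₀ := g (n - 1)) (g₁ := g n) (h := h n) (M₀ := M (n - 1))
        (M₁ := M n) (N := N n) hsc_pos hc0 ha0 ha1 (by positivity) he1
        (by rw [hy n hn2]; simp only [hd]; abel)
        (hstep n (by omega)) (hmono n)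
      have hd' : y n - x n - sc • (h n + N n) = d (n + 1) := by
        simp only [hd, Nat.add_sub_cancel]
        rw [hx n (by omega)]
        abel
      rw [hd'] at key
      have := weighted_velocity_step hα hnα hsc_pos (hF n) hc0 (norm_nonneg (d n)) (hρ0 n)
        (norm_nonneg (g (n - 1))) (hQ0 n) key
      simpa only [hA, Nat.cast_add, Nat.cast_one] using this)
  have hl0 : l = 0 := by
    refine eq_zero_of_tendsto_of_summable_div hA0 hl
      (((hF1.mul_left (2 * sc)).add hdsum).congr fun n => ?_)
    rcases Nat.eq_zero_or_pos n with rfl | hn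
    · simp
    · have : (n : ℝ) ≠ 0 := by positivity
      simp only [hA]
      field_simp
  rwa [hl0] at hl

end Sequences

/-- Theorem 2.2(ii): with constant step-size, `‖x_k − x_{k−1}‖ = o(1/k)`. -/
theorem igahd_velocity_little_o
    {H : Type*} [NormedAddCommGroup H] [InnerProductSpace ℝ H] [CompleteSpace H]
    (f : H → ℝ) (f' : H → H) (L : ℝ) (hL : 0 < L)
    (hconv : ConvexOn ℝ Set.univ f)
    (hdiff : ∀ z, HasGradientAt f (f' z) z)
    (hlip : ∀ z w, ‖f' z - f' w‖ ≤ L * ‖z - w‖)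
    (xstar : H) (hmin : ∀ z, f xstar ≤ f z)
    (α : ℝ) (hα : 3 < α)
    (s β : ℕ → ℝ) (hs0 : s 0 = 0) (hβ0 : β 0 = 0)
    -- constant step-size `s_k ≡ sc ∈ (0, 1/L]` and damping `β_k ≡ η √sc / 2`
    (sc : ℝ) (hsc_pos : 0 < sc) (hsc_le : sc ≤ 1 / L)
    (hs_const : ∀ k, 1 ≤ k → s k = sc)
    (η : ℝ) (hη0 : 0 < η) (hη1 : η ≤ 1)
    (hβ : ∀ k, 1 ≤ k → β k = η * Real.sqrt sc / 2)
    (x y Mx My : ℕ → H)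
    (hx_init : x 1 = x 0)
    (hy : ∀ k, 1 ≤ k → y k = x k + (1 - α / (k : ℝ)) • (x k - x (k - 1))
        - (β k * Real.sqrt (s k)) • (f' (x k) + Mx k)
        + (β (k - 1) * Real.sqrt (s (k - 1)) * (1 - 1 / (k : ℝ))) •
            (f' (x (k - 1)) + Mx (k - 1)))
    (hx : ∀ k, 1 ≤ k → x (k + 1) = y k - s k • (f' (y k) + My k))
    (hJ0x : Summable fun k : ℕ => s k * (k : ℝ) * ‖Mx k‖)
    (hJ0y : Summable fun k : ℕ => s k * (k : ℝ) * ‖My k‖) :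
    Tendsto (fun k : ℕ => (k : ℝ) * ‖x k - x (k - 1)‖) atTop (nhds 0) := by
  obtain ⟨b, hb⟩ : ∃ b, b = η / 2 := ⟨_, rfl⟩
  have hb0 : 0 < b := by linarith
  have hb1 : b ≤ 1 := by linarith
  obtain ⟨c, hc⟩ : ∃ c, c = b * sc := ⟨_, rfl⟩
  have hc0 : 0 < c := by rw [hc]; positivity
  have hβs : ∀ k, 1 ≤ k → β k * Real.sqrt (s k) = c := fun k hk => by
    rw [hβ k hk, hs_const k hk, hc, hb]
    linear_combination η / 2 * Real.mul_self_sqrt hsc_pos.le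
  have hy' : ∀ k, 2 ≤ k → y k = x k + (1 - α / (k : ℝ)) • (x k - x (k - 1))
      - c • (f' (x k) + Mx k)
      + (c * (1 - 1 / (k : ℝ))) • (f' (x (k - 1)) + Mx (k - 1)) := fun k hk => by
    rw [hy k (by omega), hβs k (by omega), hβs (k - 1) (by omega)]
  have hx' : ∀ k, 1 ≤ k → x (k + 1) = y k - sc • (f' (y k) + My k) := fun k hk => by
    rw [hx k hk, hs_const k hk]
  have hgrad_min : f' xstar = 0 := by
    have h1 : IsLocalMin f xstar := Eventually.of_forall hmin
    simpa using h1.hasFDerivAt_eq_zero (hdiff xstar).hasFDerivAt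
  have hJ : ∀ M : ℕ → H, (Summable fun k : ℕ => s k * (k : ℝ) * ‖M k‖) →
      Summable fun k : ℕ => (k : ℝ) * ‖M k‖ := fun M hM => by
    refine (hM.mul_left (1 / sc)).congr fun k => ?_
    rcases Nat.eq_zero_or_pos k with rfl | hk
    · simp
    · rw [hs_const k hk]
      field_simp
  have hM1 := hJ Mx hJ0x
  have hN1 := hJ My hJ0y
  set F : ℕ → ℝ := fun n => f (x n) - f xstar with hFdef
  have hF : ∀ n, 0 ≤ F n := fun n => sub_nonneg.2 (hmin _)
  have hstep : ∀ n, 1 ≤ n → ∀ z, f (x (n + 1)) ≤ f z + inner ℝ (f' (y n)) (y n - z)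
      - sc / 2 * ‖f' (y n) - f' z‖ ^ 2 - sc / 2 * ‖f' (y n)‖ ^ 2 + sc / 2 * ‖My n‖ ^ 2 := by
    intro n hn z
    rw [hx' n hn]
    exact hconv.inexact_gradient_step_le hL hsc_pos hsc_le hdiff hlip (y n) z (My n)
  have hstep_x : ∀ n, 1 ≤ n → F (n + 1) ≤ F n + inner ℝ (f' (y n)) (y n - x n)
      - sc / 2 * ‖f' (y n) - f' (x n)‖ ^ 2 - sc / 2 * ‖f' (y n)‖ ^ 2
      + sc / 2 * ‖My n‖ ^ 2 := fun n hn => by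
    have := hstep n hn (x n)
    simp only [hFdef]
    linarith
  have hstep_min : ∀ n, 1 ≤ n → F (n + 1) ≤ inner ℝ (f' (y n)) (y n - xstar)
      - sc * ‖f' (y n)‖ ^ 2 + sc / 2 * ‖My n‖ ^ 2 := fun n hn => by
    have := hstep n hn xstar
    rw [hgrad_min, sub_zero] at this
    simp only [hFdef]
    linarith
  have hmono : ∀ n, 0 ≤ inner ℝ (x n - x (n - 1)) (f' (x n) - f' (x (n - 1))) := fun n => by
    rw [real_inner_comm]
    exact hconv.inner_gradient_sub_nonneg hdiff (x n) (x (n - 1))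
  obtain ⟨hF1, hgh⟩ := summable_gap_and_gradients hα hsc_pos hb0 hb1 hc hF hy' hx' hstep_x
    hstep_min hM1 hN1
  have hl := tendsto_velocity_energy_zero hα hsc_pos hc0 hF hy' hx' hstep_x hmono hM1 hN1 hF1 hgh
  have hsqrt := (Real.continuous_sqrt.tendsto 0).comp hl
  rw [Real.sqrt_zero] at hsqrt
  refine squeeze_zero (fun n => by positivity) (fun n => ?_) hsqrt
  refine Real.le_sqrt_of_sq_le ?_
  have := hF n
  rw [mul_pow]
  exact mul_le_mul_of_nonneg_left (le_add_of_nonneg_left (by positivity)) (by positivity)
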